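/- Existence and uniqueness of the degrees-of-freedom update (equation (30) and Proposition 1 of Liu–Rubin applied there): let c < −1 and define f(ν) = (ν/2) log(ν/2) − log Γ(ν/2) + c ν/2 for ν > 0, where Γ is the real Gamma function. Then f has a unique global maximizer ν* on (0, ∞), and ν* is the unique solution in (0, ∞) of the equation log(ν/2) + 1 − ψ(ν/2) + c = 0, where ψ is the digamma function ψ(x) = d/dx log Γ(x). -/

import Mathlib

open Real Filter

/-- The digamma function `ψ(x) = d/dx log Γ(x)`. -/
noncomputable def digamma (x : ℝ) : ℝ :=
  deriv (fun y => Real.log (Real.Gamma y)) x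

/-- `log Γ` is differentiable on the positive reals, with derivative `digamma`. -/
lemma hasDerivAt_log_Gamma {x : ℝ} (hx : 0 < x) :
    HasDerivAt (fun y => Real.log (Real.Gamma y)) (digamma x) x := by
  have hd : DifferentiableAt ℝ Real.Gamma x :=
    Real.differentiableAt_Gamma fun m => by
      have : (0 : ℝ) ≤ m := m.cast_nonneg
      linarith
  exact (hd.log (Real.Gamma_pos_of_pos hx).ne').hasDerivAt

lemma log_Gamma_add_one {x : ℝ} (hx : 0 < x) :
    Real.log (Real.Gamma (x + 1)) = Real.log (Real.Gamma x) + Real.log x := by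
  rw [Real.Gamma_add_one hx.ne', Real.log_mul hx.ne' (Real.Gamma_pos_of_pos hx).ne', add_comm]

lemma digamma_add_one {x : ℝ} (hx : 0 < x) : digamma (x + 1) = digamma x + 1 / x := by
  have h1 : HasDerivAt (fun y => Real.log (Real.Gamma (y + 1))) (digamma (x + 1)) x :=
    (hasDerivAt_log_Gamma (by linarith : 0 < x + 1)).comp_add_const x 1
  have h2 : HasDerivAt (fun y => Real.log (Real.Gamma y) + Real.log y)
      (digamma x + x⁻¹) x :=
    (hasDerivAt_log_Gamma hx).add (Real.hasDerivAt_log hx.ne')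
  rw [one_div]
  refine h1.unique (h2.congr_of_eventuallyEq ?_)
  filter_upwards [lt_mem_nhds hx] with y hy using log_Gamma_add_one hy

lemma digamma_le_log {x : ℝ} (hx : 0 < x) : digamma x ≤ Real.log x := by
  have h := Real.convexOn_log_Gamma.le_slope_of_hasDerivAt (x := x) (y := x + 1) hx
    (by simp only [Set.mem_Ioi]; linarith) (by linarith) (hasDerivAt_log_Gamma hx)
  simpa [slope_def_field, log_Gamma_add_one hx] using h

lemma log_le_digamma_add_one {x : ℝ} (hx : 0 < x) : Real.log x ≤ digamma (x + 1) := by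
  have hx' : 0 < x + 1 := by linarith
  have h := Real.convexOn_log_Gamma.slope_le_of_hasDerivAt (x := x) (y := x + 1) hx
    hx' (by linarith) (hasDerivAt_log_Gamma hx')
  simpa [slope_def_field, log_Gamma_add_one hx] using h

lemma log_sub_digamma_le {x : ℝ} (hx : 0 < x) : Real.log x - digamma x ≤ 1 / x := by
  linarith [log_le_digamma_add_one hx, digamma_add_one hx]

/-- The forward difference of `digamma - log` is strictly decreasing. -/
lemma strictAntiOn_one_div_add_log_sub :
    StrictAntiOn (fun x : ℝ => 1 / x + Real.log x - Real.log (x + 1)) (Set.Ioi 0) := by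
  have hd : ∀ x : ℝ, 0 < x → HasDerivAt
      (fun x : ℝ => 1 / x + Real.log x - Real.log (x + 1))
      (-(x ^ 2)⁻¹ + x⁻¹ - (x + 1)⁻¹) x := fun x hx => by
    have h := ((hasDerivAt_inv hx.ne').add (Real.hasDerivAt_log hx.ne')).sub
      ((Real.hasDerivAt_log (by linarith : x + 1 ≠ 0)).comp_add_const x 1)
    simp only [one_div]
    exact h
  refine strictAntiOn_of_deriv_neg (convex_Ioi 0)
    (fun x hx => (hd x hx).continuousAt.continuousWithinAt) fun x hx => ?_
  rw [interior_Ioi] at hx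
  have hx : 0 < x := hx
  rw [(hd x hx).deriv]
  have : -(x ^ 2)⁻¹ + x⁻¹ - (x + 1)⁻¹ = -(1 / (x ^ 2 * (x + 1))) := by
    field_simp
    ring
  rw [this, neg_lt_zero]
  positivity

lemma log_sub_digamma_eq {x : ℝ} (hx : 0 < x) :
    Real.log x - digamma x = (1 / x + Real.log x - Real.log (x + 1)) +
      (Real.log (x + 1) - digamma (x + 1)) := by
  rw [digamma_add_one hx]
  ring

lemma log_sub_digamma_shift_le {x y : ℝ} (hx : 0 < x) (hxy : x ≤ y) (n : ℕ) :
    (Real.log (x + n) - digamma (x + n)) - (Real.log (y + n) - digamma (y + n)) ≤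
      (Real.log x - digamma x) - (Real.log y - digamma y) := by
  induction n with
  | zero => simp
  | succ n ih =>
    have hn : (0 : ℝ) ≤ n := n.cast_nonneg
    have hxn : 0 < x + n := by linarith
    have hyn : 0 < y + n := by linarith
    have h := strictAntiOn_one_div_add_log_sub.antitoneOn hxn hyn (by linarith)
    push_cast
    rw [← add_assoc, ← add_assoc]
    linarith [log_sub_digamma_eq hxn, log_sub_digamma_eq hyn]

lemma antitoneOn_log_sub_digamma :
    AntitoneOn (fun x => Real.log x - digamma x) (Set.Ioi 0) := by
  intro x hx y hy hxy
  have hx : 0 < x := hx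
  have hlim : Tendsto (fun n : ℕ => -(1 / (y + (n : ℝ)))) atTop (nhds 0) := by
    have h := (tendsto_atTop_add_const_left atTop y
      (tendsto_natCast_atTop_atTop (R := ℝ))).inv_tendsto_atTop.neg
    simpa [one_div] using h
  refine sub_nonneg.mp (le_of_tendsto' hlim fun n => ?_)
  have hn : (0 : ℝ) ≤ n := n.cast_nonneg
  linarith [log_sub_digamma_shift_le hx hxy n, digamma_le_log (by linarith : 0 < x + n),
    log_sub_digamma_le (by linarith : 0 < y + n)]

lemma strictAntiOn_log_sub_digamma :
    StrictAntiOn (fun x => Real.log x - digamma x) (Set.Ioi 0) := by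
  intro x hx y hy hxy
  have hx : 0 < x := hx
  have hy : 0 < y := hy
  have h1 := strictAntiOn_one_div_add_log_sub hx hy hxy
  have h2 := antitoneOn_log_sub_digamma (by simp only [Set.mem_Ioi]; linarith : x + 1 ∈ Set.Ioi 0)
    (by simp only [Set.mem_Ioi]; linarith : y + 1 ∈ Set.Ioi 0) (by linarith)
  simp only at h1 h2 ⊢
  linarith [log_sub_digamma_eq hx, log_sub_digamma_eq hy]

/-- `log - digamma` is unbounded above near `0`. -/
lemma exists_lt_log_sub_digamma {K : ℝ} (hK : 0 < K) :
    ∃ x : ℝ, 0 < x ∧ K < Real.log x - digamma x := by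
  have hq := Real.quadratic_le_exp_of_nonneg (by linarith : 0 ≤ K + 2)
  have hpos : 0 < Real.exp (K + 2) - 1 := by nlinarith
  have hx : 0 < (Real.exp (K + 2) - 1)⁻¹ := inv_pos.mpr hpos
  refine ⟨_, hx, ?_⟩
  have hlog : Real.log ((Real.exp (K + 2) - 1)⁻¹ + 1) =
      K + 2 + Real.log (Real.exp (K + 2) - 1)⁻¹ := by
    nth_rewrite 2 [← Real.log_exp (K + 2)]
    rw [← Real.log_mul (Real.exp_pos _).ne' hx.ne']
    congr 1
    field_simp
    ring
  have h := log_sub_digamma_eq hx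
  rw [hlog, one_div, inv_inv] at h
  have h' := digamma_le_log (by linarith : 0 < (Real.exp (K + 2) - 1)⁻¹ + 1)
  rw [hlog] at h'
  nlinarith

lemma hasDerivAt_mul_log_sub_log_Gamma (c : ℝ) {x : ℝ} (hx : 0 < x) :
    HasDerivAt (fun y => y * Real.log y - Real.log (Real.Gamma y) + c * y)
      (Real.log x + 1 - digamma x + c) x := by
  have h := ((Real.hasDerivAt_mul_log hx.ne').sub (hasDerivAt_log_Gamma hx)).add
    ((hasDerivAt_id x).const_mul c)
  rw [mul_one] at h
  exact h

/-- By Darboux's theorem, `log - digamma` takes every positive value. -/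
lemma exists_log_sub_digamma_eq {K : ℝ} (hK : 0 < K) :
    ∃ x : ℝ, 0 < x ∧ Real.log x - digamma x = K := by
  obtain ⟨a, ha, haK⟩ := exists_lt_log_sub_digamma hK
  have hb : 0 < 2 / K := by positivity
  have hbK : Real.log (2 / K) - digamma (2 / K) < K := by
    have h := log_sub_digamma_le hb
    rw [one_div_div] at h
    linarith
  have hconv := (convex_Ioi (0 : ℝ)).image_hasDerivWithinAt
    (f := fun y => y * Real.log y - Real.log (Real.Gamma y) + -1 * y)
    (f' := fun x => Real.log x + 1 - digamma x + -1)
    fun x hx => (hasDerivAt_mul_log_sub_log_Gamma (-1) hx).hasDerivWithinAt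
  obtain ⟨x, hx, h⟩ : K ∈ (fun x => Real.log x + 1 - digamma x + -1) '' Set.Ioi 0 :=
    hconv.ordConnected.out (Set.mem_image_of_mem _ hb)
      (Set.mem_image_of_mem _ ha) ⟨by linarith, by linarith⟩
  simp only at h
  exact ⟨x, hx, by linarith⟩

/-- Existence and uniqueness of the degrees-of-freedom update (equation (30)): for `c < −1`,
the function `f(ν) = (ν/2) log(ν/2) − log Γ(ν/2) + cν/2` has a unique global maximizer
`ν*` on `(0, ∞)`, which is the unique positive solution of
`log(ν/2) + 1 − ψ(ν/2) + c = 0`. -/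
theorem nu_update_exists_unique (c : ℝ) (hc : c < -1) :
    ∃ νs : ℝ, 0 < νs ∧
      (∀ ν : ℝ, 0 < ν →
        (ν / 2) * Real.log (ν / 2) - Real.log (Real.Gamma (ν / 2)) + c * ν / 2 ≤
          (νs / 2) * Real.log (νs / 2) - Real.log (Real.Gamma (νs / 2)) + c * νs / 2) ∧
      (∀ ν : ℝ, 0 < ν →
        (ν / 2) * Real.log (ν / 2) - Real.log (Real.Gamma (ν / 2)) + c * ν / 2 =
          (νs / 2) * Real.log (νs / 2) - Real.log (Real.Gamma (νs / 2)) + c * νs / 2 →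
        ν = νs) ∧
      ∀ ν : ℝ, 0 < ν →
        (Real.log (ν / 2) + 1 - digamma (ν / 2) + c = 0 ↔ ν = νs) := by
  obtain ⟨x, hx, hxc⟩ := exists_log_sub_digamma_eq (by linarith : 0 < -1 - c)
  have hd := fun y (hy : 0 < y) => hasDerivAt_mul_log_sub_log_Gamma c hy
  have hlt : ∀ y : ℝ, 0 < y → y ≠ x →
      y * Real.log y - Real.log (Real.Gamma y) + c * y <
        x * Real.log x - Real.log (Real.Gamma x) + c * x := by
    intro y hy hyx
    rcases lt_or_gt_of_ne hyx with h | h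
    · refine strictMonoOn_of_deriv_pos (convex_Icc y x)
        (fun z hz => (hd z (hy.trans_le hz.1)).continuousAt.continuousWithinAt) (fun z hz => ?_)
        (Set.left_mem_Icc.mpr h.le) (Set.right_mem_Icc.mpr h.le) h
      rw [interior_Icc] at hz
      have hz0 : 0 < z := hy.trans hz.1
      rw [(hd z hz0).deriv]
      have := strictAntiOn_log_sub_digamma hz0 hx hz.2
      simp only at this
      linarith
    · refine strictAntiOn_of_deriv_neg (convex_Icc x y)
        (fun z hz => (hd z (hx.trans_le hz.1)).continuousAt.continuousWithinAt) (fun z hz => ?_)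
        (Set.left_mem_Icc.mpr h.le) (Set.right_mem_Icc.mpr h.le) h
      rw [interior_Icc] at hz
      have hz0 : 0 < z := hx.trans hz.1
      rw [(hd z hz0).deriv]
      have := strictAntiOn_log_sub_digamma hx hz0 hz.1
      simp only at this
      linarith
  refine ⟨2 * x, by linarith, ?_⟩
  simp only [mul_div_assoc, mul_div_cancel_left₀ x (two_ne_zero' ℝ)]
  refine ⟨fun ν hν => ?_, fun ν hν h => ?_, fun ν hν => ⟨fun h => ?_, ?_⟩⟩
  · by_cases hne : ν / 2 = x
    · rw [hne]
    · exact (hlt _ (half_pos hν) hne).le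
  · by_contra hne
    exact (hlt (ν / 2) (half_pos hν) fun h' => hne (by linarith)).ne h
  · have := strictAntiOn_log_sub_digamma.injOn (half_pos hν) hx
      (by linarith)
    linarith
  · rintro rfl
    rw [mul_div_cancel_left₀ x (two_ne_zero' ℝ)]
    linarith
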